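/- Let S be a finite inverse semigroup, U ≤ S an inverse subsemigroup, s, t ∈ S, and let X be one of Green's relations L, R, J of S. If s X t holds in S, then s ≤_{X_U} t if and only if t ≤_{X_U} s. -/

import Mathlib

/-- `U¹ = U ∪ {1}`, viewed inside `S¹ = WithOne S`. -/
def Uone {S : Type*} [Semigroup S] (U : Set S) : Set (WithOne S) :=
  insert 1 ((fun a : S => (a : WithOne S)) '' U)

/-- `s ≤_{L_U} t`, i.e. `U¹ s ⊆ U¹ t`. -/
def leLrel {S : Type*} [Semigroup S] (U : Set S) (s t : S) : Prop :=
  {z : WithOne S | ∃ x ∈ Uone U, z = x * (s : WithOne S)} ⊆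
    {z : WithOne S | ∃ x ∈ Uone U, z = x * (t : WithOne S)}

/-- `s ≤_{R_U} t`, i.e. `s U¹ ⊆ t U¹`. -/
def leRrel {S : Type*} [Semigroup S] (U : Set S) (s t : S) : Prop :=
  {z : WithOne S | ∃ x ∈ Uone U, z = (s : WithOne S) * x} ⊆
    {z : WithOne S | ∃ x ∈ Uone U, z = (t : WithOne S) * x}

/-- `s ≤_{J_U} t`, i.e. `U¹ s U¹ ⊆ U¹ t U¹`. -/
def leJrel {S : Type*} [Semigroup S] (U : Set S) (s t : S) : Prop :=
  {z : WithOne S | ∃ x ∈ Uone U, ∃ y ∈ Uone U, z = x * (s : WithOne S) * y} ⊆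
    {z : WithOne S | ∃ x ∈ Uone U, ∃ y ∈ Uone U, z = x * (t : WithOne S) * y}

/-- Green's relation `L` on `S` (the case `U = S`). -/
def greenL {S : Type*} [Semigroup S] (s t : S) : Prop :=
  leLrel Set.univ s t ∧ leLrel Set.univ t s

/-- Green's relation `R` on `S` (the case `U = S`). -/
def greenR {S : Type*} [Semigroup S] (s t : S) : Prop :=
  leRrel Set.univ s t ∧ leRrel Set.univ t s

/-- Green's relation `J` on `S` (the case `U = S`). -/
def greenJ {S : Type*} [Semigroup S] (s t : S) : Prop :=
  leJrel Set.univ s t ∧ leJrel Set.univ t s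

theorem idem_comm {M : Type*} [Monoid M] (inv : M → M)
    (h1 : ∀ x : M, x * inv x * x = x)
    (h2 : ∀ x : M, inv x * x * inv x = inv x)
    (hu : ∀ x y : M, x * y * x = x → y * x * y = y → y = inv x)
    (e f : M) (he : e * e = e) (hf : f * f = f) : e * f = f * e := by
  have key : ∀ e f : M, e * e = e → f * f = f →
      inv (e * f) = e * f ∧ (e * f) * (e * f) = e * f := by
    intro e f he hf
    have a1 := h1 (e * f)
    have a2 := h2 (e * f)
    set x := inv (e * f) with hx
    have he' : ∀ z, e * (e * z) = e * z := fun z => by rw [← mul_assoc, he]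
    have hf' : ∀ z, f * (f * z) = f * z := fun z => by rw [← mul_assoc, hf]
    have b : f * x * e = x := by
      apply hu
      · simp only [mul_assoc] at *
        rw [hf', he', a1]
      · have a3 : x * (e * (f * (x * e))) = x * e := by
          have := congrArg (· * e) a2
          simpa only [mul_assoc] using this
        simp only [mul_assoc]
        rw [he', hf', a3]
    have c : x * x = x := by
      have a3 : x * (e * (f * (x * e))) = x * e := by
        have := congrArg (· * e) a2
        simpa only [mul_assoc] using this
      calc x * x = (f * x * e) * (f * x * e) := by rw [b]
        _ = f * (x * (e * (f * (x * e)))) := by simp only [mul_assoc]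
        _ = f * x * e := by rw [a3, mul_assoc]
        _ = x := b
    have d : x = inv x := hu x x (by rw [c, c]) (by rw [c, c])
    have d' : e * f = inv x := hu x (e * f) a2 a1
    have d2 : e * f = x := d'.trans d.symm
    exact ⟨d2.symm, by rw [d2, c]⟩
  obtain ⟨k1, k2⟩ := key e f he hf
  obtain ⟨k3, k4⟩ := key f e hf he
  have he' : ∀ z, e * (e * z) = e * z := fun z => by rw [← mul_assoc, he]
  have hf' : ∀ z, f * (f * z) = f * z := fun z => by rw [← mul_assoc, hf]
  rw [← k1]
  symm
  apply hu
  · simp only [mul_assoc] at *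
    rw [hf', he', k2]
  · simp only [mul_assoc] at *
    rw [he', hf', k4]

theorem left_lem {M : Type*} [Monoid M] (inv : M → M)
    (h1 : ∀ x : M, x * inv x * x = x)
    (h2 : ∀ x : M, inv x * x * inv x = inv x)
    (hu : ∀ x y : M, x * y * x = x → y * x * y = y → y = inv x)
    (t u w : M) (h : t = w * (u * t)) : t = inv u * (u * t) := by
  have c : (inv u * u) * (t * inv t) = (t * inv t) * (inv u * u) := by
    apply idem_comm inv h1 h2 hu
    · rw [← mul_assoc, h2]
    · rw [← mul_assoc, h1]
  have tf : t * (inv t * (inv u * (u * t))) = inv u * (u * t) := by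
    calc _ = (t * inv t) * (inv u * u) * t := by simp only [mul_assoc]
      _ = (inv u * u) * (t * inv t * t) := by rw [← c]; simp only [mul_assoc]
      _ = _ := by rw [h1, mul_assoc]
  calc t = w * (u * t) := h
    _ = w * ((u * inv u * u) * t) := by rw [h1]
    _ = w * (u * (inv u * (u * t))) := by simp only [mul_assoc]
    _ = w * (u * (t * (inv t * (inv u * (u * t))))) := by rw [tf]
    _ = (w * (u * t)) * (inv t * (inv u * (u * t))) := by simp only [mul_assoc]
    _ = _ := by rw [← h, tf]

theorem right_lem {M : Type*} [Monoid M] (inv : M → M)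
    (h1 : ∀ x : M, x * inv x * x = x)
    (h2 : ∀ x : M, inv x * x * inv x = inv x)
    (hu : ∀ x y : M, x * y * x = x → y * x * y = y → y = inv x)
    (t v w : M) (h : t = t * v * w) : t = t * v * inv v := by
  have c : (v * inv v) * (inv t * t) = (inv t * t) * (v * inv v) := by
    apply idem_comm inv h1 h2 hu
    · rw [← mul_assoc, h1]
    · rw [← mul_assoc, h2]
  have tf : (t * v * inv v * inv t) * t = t * v * inv v := by
    calc _ = t * ((v * inv v) * (inv t * t)) := by simp only [mul_assoc]
      _ = (t * inv t * t) * (v * inv v) := by rw [c]; simp only [mul_assoc]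
      _ = _ := by rw [h1, mul_assoc]
  calc t = t * v * w := h
    _ = t * (v * inv v * v) * w := by rw [h1]
    _ = (t * v * inv v) * v * w := by simp only [mul_assoc]
    _ = (t * v * inv v * inv t) * t * v * w := by rw [tf]
    _ = (t * v * inv v * inv t) * (t * v * w) := by simp only [mul_assoc]
    _ = _ := by rw [← h, tf]

theorem stab {M : Type*} [Monoid M] [Finite M] (a t b : M) (h : t = a * t * b) :
    (∃ w, t = w * a * t) ∧ ∃ w, t = t * (b * w) := by
  have hp : ∀ n : ℕ, a ^ n * t * b ^ n = t := by
    intro n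
    induction n with
    | zero => simp
    | succ n ih =>
      calc a ^ (n+1) * t * b ^ (n+1) = a ^ n * (a * t * b) * b ^ n := by
            rw [pow_succ, pow_succ']; simp only [mul_assoc]
        _ = t := by rw [← h, ih]
  have pig : ∀ c : M, ∃ m k : ℕ, c ^ m = c ^ (m + (k + 1)) := by
    intro c
    obtain ⟨m, n, hne, he⟩ := Finite.exists_ne_map_eq_of_infinite (fun n : ℕ => c ^ n)
    rcases lt_or_gt_of_ne hne with hl | hl
    · exact ⟨m, n - m - 1, by rw [show m + (n - m - 1 + 1) = n by omega]; exact he⟩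
    · exact ⟨n, m - n - 1, by rw [show n + (m - n - 1 + 1) = m by omega]; exact he.symm⟩
  constructor
  · obtain ⟨m, k, hk⟩ := pig a
    refine ⟨a ^ k, ?_⟩
    calc t = a ^ m * t * b ^ m := (hp m).symm
      _ = a ^ (k + 1) * (a ^ m * t * b ^ m) := by
        conv_lhs => rw [hk, add_comm, pow_add]
        simp only [mul_assoc]
      _ = _ := by rw [hp, pow_succ]
  · obtain ⟨m, k, hk⟩ := pig b
    refine ⟨b ^ k, ?_⟩
    calc t = a ^ m * t * b ^ m := (hp m).symm
      _ = (a ^ m * t * b ^ m) * b ^ (k + 1) := by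
        conv_lhs => rw [hk, pow_add]
        simp only [mul_assoc]
      _ = _ := by rw [hp, pow_succ']

theorem Uone_one {S : Type*} [Semigroup S] (U : Set S) : (1 : WithOne S) ∈ Uone U :=
  Set.mem_insert _ _

theorem Uone_mul {S : Type*} [Semigroup S] (U : Set S)
    (hUmul : ∀ a ∈ U, ∀ b ∈ U, a * b ∈ U) (x y : WithOne S)
    (hx : x ∈ Uone U) (hy : y ∈ Uone U) : x * y ∈ Uone U := by
  rcases hx with rfl | ⟨a, ha, rfl⟩
  · simpa using hy
  · rcases hy with rfl | ⟨b, hb, rfl⟩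
    · rw [mul_one]; exact Or.inr ⟨a, ha, rfl⟩
    · exact Or.inr ⟨a * b, hUmul a ha b hb, by simp⟩

def invOne {S : Type*} (inv : S → S) : WithOne S → WithOne S := 
  WithOne.recOneCoe 1 (fun a => (inv a : WithOne S))

theorem Uone_inv {S : Type*} [Semigroup S] (inv : S → S) (U : Set S)
    (hUinv : ∀ a ∈ U, inv a ∈ U) (x : WithOne S)
    (hx : x ∈ Uone U) : invOne inv x ∈ Uone U := by
  rcases hx with rfl | ⟨a, ha, rfl⟩
  · exact Uone_one U
  · exact Or.inr ⟨inv a, hUinv a ha, rfl⟩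

theorem leL_iff {S : Type*} [Semigroup S] (U : Set S)
    (hUmul : ∀ a ∈ U, ∀ b ∈ U, a * b ∈ U) (s t : S) :
    leLrel U s t ↔ ∃ x ∈ Uone U, (s : WithOne S) = x * t := by
  constructor
  · intro h
    exact h ⟨1, Uone_one U, by simp⟩
  · rintro ⟨x, hx, h⟩ z ⟨y, hy, rfl⟩
    exact ⟨y * x, Uone_mul U hUmul _ _ hy hx, by rw [h, mul_assoc]⟩

theorem leR_iff {S : Type*} [Semigroup S] (U : Set S)
    (hUmul : ∀ a ∈ U, ∀ b ∈ U, a * b ∈ U) (s t : S) :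
    leRrel U s t ↔ ∃ x ∈ Uone U, (s : WithOne S) = t * x := by
  constructor
  · intro h
    exact h ⟨1, Uone_one U, by simp⟩
  · rintro ⟨x, hx, h⟩ z ⟨y, hy, rfl⟩
    exact ⟨x * y, Uone_mul U hUmul _ _ hx hy, by rw [h, mul_assoc]⟩

theorem leJ_iff {S : Type*} [Semigroup S] (U : Set S)
    (hUmul : ∀ a ∈ U, ∀ b ∈ U, a * b ∈ U) (s t : S) :
    leJrel U s t ↔ ∃ x ∈ Uone U, ∃ y ∈ Uone U, (s : WithOne S) = x * t * y := by
  constructor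
  · intro h
    exact h ⟨1, Uone_one U, 1, Uone_one U, by simp⟩
  · rintro ⟨x, hx, y, hy, h⟩ z ⟨x', hx', y', hy', rfl⟩
    exact ⟨x' * x, Uone_mul U hUmul _ _ hx' hx, y * y', Uone_mul U hUmul _ _ hy hy',
      by rw [h]; simp only [mul_assoc]⟩

/-- Let `S` be a finite inverse semigroup, `U ≤ S` an inverse
subsemigroup, `s, t ∈ S`, and let `X` be one of Green's relations `L`, `R`, `J` of `S`.
If `s X t` holds in `S`, then `s ≤_{X_U} t` if and only if `t ≤_{X_U} s`. -/
theorem stmt_1 {S : Type*} [Semigroup S] [Finite S] (inv : S → S)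
    (hinv1 : ∀ x : S, x * inv x * x = x)
    (hinv2 : ∀ x : S, inv x * x * inv x = inv x)
    (hinvUniq : ∀ x y : S, x * y * x = x → y * x * y = y → y = inv x)
    (U : Set S) (hUmul : ∀ a ∈ U, ∀ b ∈ U, a * b ∈ U) (hUinv : ∀ a ∈ U, inv a ∈ U)
    (s t : S) :
    (greenL s t → (leLrel U s t ↔ leLrel U t s)) ∧
    (greenR s t → (leRrel U s t ↔ leRrel U t s)) ∧
    (greenJ s t → (leJrel U s t ↔ leJrel U t s)) := by
  have h1 : ∀ x : WithOne S, x * invOne inv x * x = x := by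
    intro x
    induction x using WithOne.recOneCoe with
    | one => simp [invOne]
    | coe a => exact congrArg _ (hinv1 a)
  have h2 : ∀ x : WithOne S, invOne inv x * x * invOne inv x = invOne inv x := by
    intro x
    induction x using WithOne.recOneCoe with
    | one => simp [invOne]
    | coe a => exact congrArg _ (hinv2 a)
  have hu : ∀ x y : WithOne S, x * y * x = x → y * x * y = y → y = invOne inv x := by
    intro x y hx hy
    induction x using WithOne.recOneCoe with
    | one => simpa [invOne] using hx
    | coe a =>
      induction y using WithOne.recOneCoe with
      | one =>
        rw [one_mul, mul_one] at hy
        exact absurd hy WithOne.coe_ne_one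
      | coe b =>
        exact congrArg _ (hinvUniq a b (WithOne.coe_injective hx) (WithOne.coe_injective hy))
  have : Finite (WithOne S) := inferInstanceAs (Finite (Option S))
  have hT : ∀ a ∈ (Set.univ : Set S), ∀ b ∈ (Set.univ : Set S), a * b ∈ (Set.univ : Set S) :=
    fun _ _ _ _ => trivial
  have hI := Uone_inv inv U hUinv
  have L : ∀ s t : S, leLrel Set.univ t s → leLrel U s t → leLrel U t s := by
    intro s t hg h
    rw [leL_iff _ hT] at hg
    rw [leL_iff _ hUmul] at h ⊢
    obtain ⟨w, -, hw⟩ := hg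
    obtain ⟨u, hu', h⟩ := h
    rw [h] at hw ⊢
    exact ⟨_, hI u hu', left_lem _ h1 h2 hu _ _ _ hw⟩
  have R : ∀ s t : S, leRrel Set.univ t s → leRrel U s t → leRrel U t s := by
    intro s t hg h
    rw [leR_iff _ hT] at hg
    rw [leR_iff _ hUmul] at h ⊢
    obtain ⟨w, -, hw⟩ := hg
    obtain ⟨u, hu', h⟩ := h
    rw [h] at hw ⊢
    exact ⟨_, hI u hu', right_lem _ h1 h2 hu _ _ _ hw⟩
  have J : ∀ s t : S, leJrel Set.univ t s → leJrel U s t → leJrel U t s := by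
    intro s t hg h
    rw [leJ_iff _ hT] at hg
    rw [leJ_iff _ hUmul] at h ⊢
    obtain ⟨x, -, y, -, hw⟩ := hg
    obtain ⟨u, hu', v, hv', h⟩ := h
    rw [h] at hw ⊢
    obtain ⟨⟨w, hw1⟩, w', hw2⟩ := stab (x * u) (t : WithOne S) (v * y)
      (hw.trans (by simp only [mul_assoc]))
    have e1 := left_lem _ h1 h2 hu (t : WithOne S) u (w * x)
      (hw1.trans (by simp only [mul_assoc]))
    have e2 := right_lem _ h1 h2 hu (t : WithOne S) v (y * w')
      (hw2.trans (by simp only [mul_assoc]))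
    refine ⟨_, hI u hu', _, hI v hv', ?_⟩
    calc (t : WithOne S) = invOne inv u * (u * t) := e1
      _ = invOne inv u * (u * (t * v * invOne inv v)) := by rw [← e2]
      _ = _ := by simp only [mul_assoc]
  exact ⟨fun g => ⟨L s t g.2, L t s g.1⟩, fun g => ⟨R s t g.2, R t s g.1⟩,
    fun g => ⟨J s t g.2, J t s g.1⟩⟩
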